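/- arXiv:2510.09381 — 6 statements merged into one kernel-verified Lean document; each statement's English description precedes it below -/
import Mathlib

section
/- (Necessity direction of the 1R-LOCC_m hierarchy.) Let (q_r)_{r=1}^N be a probability distribution, for each r let (A_r^a)_{a=1}^m be an m-outcome POVM on ℂ^{d_A} and, for each a, let (B_r^{λ|a})_{λ=1}^n be an n-outcome POVM on ℂ^{d_B}, and set M^λ := Σ_r Σ_{a=1}^m q_r · A_r^a ⊗ B_r^{λ|a}. Then for every k ∈ ℕ the operators R^{a⃗,λ,b} := Σ_r q_r · A_r^{a_1} ⊗ … ⊗ A_r^{a_k} ⊗ B_r^{λ|b} (for a⃗ ∈ {1,…,m}^k, λ ∈ {1,…,n}, b ∈ {1,…,m}) are positive semidefinite and satisfy: (i) M^λ = d_A^{-(k-1)} Σ_{a⃗} Tr_{A_1…A_{k-1}}(R^{a_1…a_k,λ,a_k}); (ii) Σ_{a_1} R^{a_1 a_2…a_k,λ,b} = (𝟙_{d_A}/d_A) ⊗ Σ_{a_1} Tr_{A_1}(R^{a_1…a_k,λ,b}); (iii) Σ_λ R^{a⃗,λ,b} = (Σ_λ Σ_{b'} Tr_B(R^{a⃗,λ,b'}))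 ⊗ 𝟙_{d_B}/(m d_B); (iv) (U_{k,d_A}^σ ⊗ 𝟙) R^{a⃗,λ,b} (U_{k,d_A}^{σ^{-1}} ⊗ 𝟙) = R^{σ(a⃗),λ,b} for all σ ∈ S_k; (v) the partial transpose of R^{a⃗,λ,b} over any initial segment of the A-factors is positive semidefinite; (vi) Σ_{a⃗,λ} Tr(R^{a⃗,λ,b}) = d_A^k d_B for all b. -/
open scoped Kronecker BigOperators ComplexOrder
open Matrix

noncomputable section

/-- An `N`-outcome POVM on `ℂ^d`: positive semidefinite matrices summing to the identity. -/
def IsPOVM {d N : ℕ} (A : Fin N → Matrix (Fin d) (Fin d) ℂ) : Prop :=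
  (∀ a, (A a).PosSemidef) ∧ ∑ a, A a = 1

/-- Index set of `(ℂ^{dA})^{⊗ k} ⊗ ℂ^{dB}`. -/
abbrev OpIdx (dA dB k : ℕ) := (Fin k → Fin dA) × Fin dB

/-- Operators on `(ℂ^{dA})^{⊗ k} ⊗ ℂ^{dB}`. -/
abbrev Op (dA dB k : ℕ) := Matrix (OpIdx dA dB k) (OpIdx dA dB k) ℂ

/-- Partial trace over the first `k` A-factors (all A-factors but the last one). -/
def ptraceAinit {dA dB k : ℕ} (R : Op dA dB (k + 1)) :
    Matrix (Fin dA × Fin dB) (Fin dA × Fin dB) ℂ :=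
  Matrix.of fun p q => ∑ v : Fin k → Fin dA,
    R (Fin.snoc v p.1, p.2) (Fin.snoc v q.1, q.2)

/-- Partial trace over the first A-factor. -/
def ptraceA1 {dA dB k : ℕ} (R : Op dA dB (k + 1)) : Op dA dB k :=
  Matrix.of fun p q => ∑ a : Fin dA, R (Fin.cons a p.1, p.2) (Fin.cons a q.1, q.2)

/-- Tensoring an operator with the identity matrix on a fresh first A-factor. -/
def idAkron {dA dB k : ℕ} (S : Op dA dB k) : Op dA dB (k + 1) :=
  Matrix.of fun p q =>
    (if p.1 0 = q.1 0 then (1 : ℂ) else 0) * S (Fin.tail p.1, p.2) (Fin.tail q.1, q.2)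

/-- Partial trace over the B-factor. -/
def ptraceB {dA dB k : ℕ} (R : Op dA dB k) :
    Matrix (Fin k → Fin dA) (Fin k → Fin dA) ℂ :=
  Matrix.of fun x y => ∑ b : Fin dB, R (x, b) (y, b)

/-- Tensoring an operator on the A-factors with the identity matrix on the B-factor. -/
def kronIdB {dA dB k : ℕ} (S : Matrix (Fin k → Fin dA) (Fin k → Fin dA) ℂ) :
    Op dA dB k :=
  Matrix.of fun p q => S p.1 q.1 * (if p.2 = q.2 then (1 : ℂ) else 0)

/-- Partial transpose over the first `ℓ` A-factors. -/
def ptransposeA {dA dB k : ℕ} (ℓ : ℕ) (R : Op dA dB k) : Op dA dB k :=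
  Matrix.of fun p q =>
    R ((fun i => if (i : ℕ) < ℓ then q.1 i else p.1 i), p.2)
      ((fun i => if (i : ℕ) < ℓ then p.1 i else q.1 i), q.2)

/-- The entrywise form of the tensor product of a finite family of matrices. -/
def piKronecker {ι : Type*} [Fintype ι] {d : ℕ} (C : ι → Matrix (Fin d) (Fin d) ℂ) :
    Matrix (ι → Fin d) (ι → Fin d) ℂ :=
  Matrix.of fun x y => ∏ i, C i (x i) (y i)

open scoped MatrixOrder in
theorem posSemidef_piKronecker {ι : Type*} [Fintype ι] {d : ℕ}
    {C : ι → Matrix (Fin d) (Fin d) ℂ} (hC : ∀ i, (C i).PosSemidef) :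
    (piKronecker C).PosSemidef := by
  classical
  have hD : ∀ i, ∃ D, C i = star D * D := fun i =>
    CStarAlgebra.nonneg_iff_eq_star_mul_self.mp (hC i).nonneg
  choose D hD using hD
  have h : piKronecker C = (piKronecker D)ᴴ * piKronecker D := by
    ext x y
    simp only [piKronecker, of_apply, mul_apply, conjTranspose_apply, star_prod,
      ← Finset.prod_mul_distrib, hD, star_eq_conjTranspose]
    rw [Finset.prod_univ_sum, Fintype.piFinset_univ]
  rw [h]
  exact posSemidef_conjTranspose_mul_self _

theorem posSemidef_sum_smul {ι n : Type*} [Fintype ι] [Fintype n] {q : ι → ℝ}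
    (hq : ∀ r, 0 ≤ q r) {C : ι → Matrix n n ℂ} (hC : ∀ r, (C r).PosSemidef) :
    (∑ r, (q r : ℂ) • C r).PosSemidef :=
  posSemidef_sum _ fun r _ => (hC r).smul (by exact_mod_cast hq r)

namespace IsPOVM

variable {d N : ℕ} {A : Fin N → Matrix (Fin d) (Fin d) ℂ}

theorem sum_apply (hA : IsPOVM A) (x y : Fin d) :
    ∑ a, A a x y = if x = y then 1 else 0 := by
  rw [← Matrix.sum_apply, hA.2, one_apply]

theorem sum_trace (hA : IsPOVM A) : ∑ a, ∑ x, A a x x = d := by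
  rw [Finset.sum_comm]
  simp [hA.sum_apply]

theorem sum_prod_trace (hA : IsPOVM A) (k : ℕ) :
    ∑ t : Fin k → Fin N, ∑ v : Fin k → Fin d, ∏ i, A (t i) (v i) (v i) = (d : ℂ) ^ k := by
  have h : ∀ t : Fin k → Fin N, ∑ v : Fin k → Fin d, ∏ i, A (t i) (v i) (v i) =
      ∏ i, ∑ x, A (t i) x x := fun t => by
    rw [Finset.prod_univ_sum, Fintype.piFinset_univ]
  simp only [h]
  rw [← Fintype.piFinset_univ, ← Finset.prod_univ_sum (fun _ => Finset.univ)
    (fun _ a => ∑ x, A a x x)]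
  simp [hA.sum_trace]

end IsPOVM

/-- **Necessity direction of the 1R-LOCC_m hierarchy.**  Given a convex combination
`M λ = ∑ r ∑ a, q_r A_r^a ⊗ B_r^{λ|a}` of `1R-LOCC_m` measurements, for every level
`k+1` the operators `R^{a⃗,λ,b} = ∑ r, q_r A_r^{a_1} ⊗ ⋯ ⊗ A_r^{a_{k+1}} ⊗ B_r^{λ|b}`
are positive semidefinite and satisfy constraints (i)–(vi). -/
theorem oneRound_LOCC_hierarchy_necessity
    (dA dB n m N : ℕ) (hdA : 0 < dA) (hdB : 0 < dB) (hn : 0 < n) (hm : 0 < m)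
    (q : Fin N → ℝ) (hq0 : ∀ r, 0 ≤ q r) (hq1 : ∑ r, q r = 1)
    (A : Fin N → Fin m → Matrix (Fin dA) (Fin dA) ℂ)
    (B : Fin N → Fin m → Fin n → Matrix (Fin dB) (Fin dB) ℂ)
    (hA : ∀ r, IsPOVM (A r)) (hB : ∀ r a, IsPOVM (B r a))
    (M : Fin n → Matrix (Fin dA × Fin dB) (Fin dA × Fin dB) ℂ)
    (hM : ∀ lam, M lam = ∑ r, ∑ a, (q r : ℂ) • (A r a ⊗ₖ B r a lam))
    (k : ℕ)
    (R : (Fin (k + 1) → Fin m) → Fin n → Fin m → Op dA dB (k + 1))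
    (hR : ∀ av lam b, R av lam b =
        ∑ r, (q r : ℂ) •
          Matrix.of (fun p p' : OpIdx dA dB (k + 1) =>
            (∏ i, A r (av i) (p.1 i) (p'.1 i)) * B r b lam p.2 p'.2)) :
    (∀ av lam b, (R av lam b).PosSemidef) ∧
    (∀ lam, M lam =
        ((dA : ℂ) ^ k)⁻¹ •
          ∑ av : Fin (k + 1) → Fin m, ptraceAinit (R av lam (av (Fin.last k)))) ∧
    (∀ (t : Fin k → Fin m) (lam : Fin n) (b : Fin m),
        ∑ a1 : Fin m, R (Fin.cons a1 t) lam b =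
          (dA : ℂ)⁻¹ • idAkron (∑ a1 : Fin m, ptraceA1 (R (Fin.cons a1 t) lam b))) ∧
    (∀ (av : Fin (k + 1) → Fin m) (b : Fin m),
        ∑ lam, R av lam b =
          ((m : ℂ) * (dB : ℂ))⁻¹ •
            kronIdB (∑ lam, ∑ b' : Fin m, ptraceB (R av lam b'))) ∧
    (∀ (σ : Equiv.Perm (Fin (k + 1))) (av : Fin (k + 1) → Fin m) (lam : Fin n)
        (b : Fin m) (p p' : OpIdx dA dB (k + 1)),
        R av lam b ((fun i => p.1 (σ i)), p.2) ((fun i => p'.1 (σ i)), p'.2) =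
          R (fun i => av (σ.symm i)) lam b p p') ∧
    (∀ (av : Fin (k + 1) → Fin m) (lam : Fin n) (b : Fin m) (ℓ : ℕ), ℓ ≤ k + 1 →
        (ptransposeA ℓ (R av lam b)).PosSemidef) ∧
    (∀ b : Fin m,
        ∑ av : Fin (k + 1) → Fin m, ∑ lam, (R av lam b).trace =
          (dA : ℂ) ^ (k + 1) * (dB : ℂ)) := by
  have hRe : ∀ av lam b p p', R av lam b p p' =
      ∑ r, (q r : ℂ) * ((∏ i, A r (av i) (p.1 i) (p'.1 i)) * B r b lam p.2 p'.2) := by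
    intro av lam b p p'
    simp [hR, Matrix.sum_apply]
  have hdA' : (dA : ℂ) ≠ 0 := by exact_mod_cast hdA.ne'
  have hdB' : (dB : ℂ) ≠ 0 := by exact_mod_cast hdB.ne'
  have hm' : (m : ℂ) ≠ 0 := by exact_mod_cast hm.ne'
  refine ⟨?_, ?_, ?_, ?_, ?_, ?_, ?_⟩
  · intro av lam b
    rw [hR]
    exact posSemidef_sum_smul hq0 fun r =>
      (posSemidef_piKronecker fun i => (hA r).1 (av i)).kronecker ((hB r b).1 lam)
  · intro lam
    rw [eq_inv_smul_iff₀ (pow_ne_zero k hdA')]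
    ext p p'
    simp only [hM, Matrix.smul_apply, Matrix.sum_apply, ptraceAinit, of_apply, hRe,
      kroneckerMap_apply, smul_eq_mul]
    rw [← (Fin.snocEquiv fun _ => Fin m).sum_comp, Fintype.sum_prod_type]
    simp only [Fin.snocEquiv_apply, Fin.prod_univ_castSucc, Fin.snoc_castSucc, Fin.snoc_last]
    simp_rw [Finset.sum_comm (s := (Finset.univ : Finset (Fin k → Fin dA)))]
    simp_rw [Finset.sum_comm (s := (Finset.univ : Finset (Fin k → Fin m)))]
    rw [Finset.mul_sum, Finset.sum_comm]
    refine Finset.sum_congr rfl fun r _ => ?_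
    rw [Finset.mul_sum]
    refine Finset.sum_congr rfl fun a _ => ?_
    rw [← (hA r).sum_prod_trace k]
    simp only [Finset.sum_mul]
    rw [Finset.sum_comm]
    refine Finset.sum_congr rfl fun v _ => ?_
    refine Finset.sum_congr rfl fun t _ => ?_
    ring
  · intro t lam b
    rw [eq_inv_smul_iff₀ hdA']
    ext p p'
    simp only [Matrix.smul_apply, Matrix.sum_apply, idAkron, ptraceA1, of_apply, hRe,
      smul_eq_mul, Fin.prod_univ_succ, Fin.cons_zero, Fin.cons_succ, Fin.tail]
    simp_rw [Finset.sum_comm (s := (Finset.univ : Finset (Fin dA)))]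
    simp_rw [Finset.sum_comm (s := (Finset.univ : Finset (Fin m)))]
    rw [Finset.mul_sum, Finset.mul_sum]
    refine Finset.sum_congr rfl fun r _ => ?_
    simp_rw [mul_assoc, ← Finset.mul_sum, ← Finset.sum_mul]
    rw [(hA r).sum_apply, Finset.sum_comm (f := fun x a => A r a x x), (hA r).sum_trace]
    ring
  · intro av b
    rw [eq_inv_smul_iff₀ (mul_ne_zero hm' hdB')]
    ext p p'
    simp only [Matrix.smul_apply, Matrix.sum_apply, kronIdB, ptraceB, of_apply, hRe, smul_eq_mul]
    simp_rw [Finset.sum_comm (s := (Finset.univ : Finset (Fin dB)))]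
    simp_rw [Finset.sum_comm (s := (Finset.univ : Finset (Fin m)))]
    simp_rw [Finset.sum_comm (s := (Finset.univ : Finset (Fin n)))]
    rw [Finset.mul_sum, Finset.sum_mul]
    refine Finset.sum_congr rfl fun r _ => ?_
    simp_rw [← Finset.mul_sum]
    simp only [(hB r _).sum_apply, if_true, Finset.sum_const, Finset.card_univ,
      Fintype.card_fin, nsmul_eq_mul, mul_one]
    ring
  · intro σ av lam b p p'
    simp only [hRe]
    refine Finset.sum_congr rfl fun r _ => ?_
    rw [← Equiv.prod_comp σ fun i => A r (av (σ.symm i)) (p.1 i) (p'.1 i)]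
    simp
  · intro av lam b ℓ _
    have h : ptransposeA ℓ (R av lam b) = ∑ r, (q r : ℂ) •
        (piKronecker (fun i : Fin (k + 1) => if (i : ℕ) < ℓ then (A r (av i))ᵀ else A r (av i)) ⊗ₖ
          B r b lam) := by
      ext p p'
      simp only [ptransposeA, of_apply, hRe, Matrix.sum_apply, Matrix.smul_apply, smul_eq_mul,
        kroneckerMap_apply, piKronecker]
      refine Finset.sum_congr rfl fun r _ => ?_
      congr 2
      refine Finset.prod_congr rfl fun i _ => ?_
      split_ifs <;> rfl
    rw [h]
    refine posSemidef_sum_smul hq0 fun r =>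
      (posSemidef_piKronecker fun i => ?_).kronecker ((hB r b).1 lam)
    split_ifs
    exacts [((hA r).1 _).transpose, (hA r).1 _]
  · intro b
    simp only [Matrix.trace, diag_apply, hRe, Fintype.sum_prod_type]
    have h : ∀ r, ∑ av : Fin (k + 1) → Fin m, ∑ lam, ∑ x : Fin (k + 1) → Fin dA, ∑ y,
        (q r : ℂ) * ((∏ i, A r (av i) (x i) (x i)) * B r b lam y y) =
        q r * ((dA : ℂ) ^ (k + 1) * dB) := fun r => by
      simp_rw [← Finset.mul_sum, ← Finset.sum_mul, ← Finset.mul_sum]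
      rw [← Finset.sum_mul, (hA r).sum_prod_trace, (hB r b).sum_trace]
    simp_rw [Finset.sum_comm (t := (Finset.univ : Finset (Fin N))), h, ← Finset.sum_mul]
    rw [← Complex.ofReal_sum, hq1, Complex.ofReal_one, one_mul]

end
end

section
/- For all real δ, τ, ξ and for each i ∈ {1,2,3,4}, the tangle of the Bell-basis state ψ_i equals sin²(2δ)·sin²(τ); that is, 2·(1 − Tr[(Tr_B(|ψ_i⟩⟨ψ_i|))²]) = sin²(2δ)·sin²(τ), where ψ_1 = sin δ |01⟩ + sin τ cos δ |10⟩ − cos τ cos δ |11⟩, ψ_2 = cos δ |01⟩ − sin τ sin δ |10⟩ + cos τ sin δ |11⟩, ψ_3 = −cos δ e^{iξ} |00⟩ + cos τ sin δ |10⟩ + sin τ sin δ |11⟩, ψ_4 = sin δ e^{iξ} |00⟩ + cos τ cos δ |10⟩ + sin τ cos δ |11⟩. -/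
open scoped BigOperators ComplexConjugate
open Matrix

noncomputable section

/-- The Bell-basis family of two-qubit states `ψ_1, ψ_2, ψ_3, ψ_4` (indexed here by
`Fin 4`), as functions `Fin 2 → Fin 2 → ℂ` on the standard product basis `|ab⟩`;
the first index is Alice's qubit. -/
def bellBasis (δ τ ξ : ℝ) : Fin 4 → Fin 2 → Fin 2 → ℂ :=
  ![ fun a b => ![![(0 : ℂ), (Real.sin δ : ℂ)],
        ![(Real.sin τ : ℂ) * (Real.cos δ : ℂ),
          -((Real.cos τ : ℂ) * (Real.cos δ : ℂ))]] a b,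
     fun a b => ![![(0 : ℂ), (Real.cos δ : ℂ)],
        ![-((Real.sin τ : ℂ) * (Real.sin δ : ℂ)),
          (Real.cos τ : ℂ) * (Real.sin δ : ℂ)]] a b,
     fun a b => ![![-(Real.cos δ : ℂ) * Complex.exp (Complex.I * (ξ : ℂ)), (0 : ℂ)],
        ![(Real.cos τ : ℂ) * (Real.sin δ : ℂ),
          (Real.sin τ : ℂ) * (Real.sin δ : ℂ)]] a b,
     fun a b => ![![(Real.sin δ : ℂ) * Complex.exp (Complex.I * (ξ : ℂ)), (0 : ℂ)],
        ![(Real.cos τ : ℂ) * (Real.cos δ : ℂ),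
          (Real.sin τ : ℂ) * (Real.cos δ : ℂ)]] a b ]

/-- The reduced state `Tr_B(|ψ⟩⟨ψ|)` of a two-qubit vector, as a `2×2` matrix:
`(Tr_B ρ)_{a,a'} = ∑_b ψ_{a b} conj(ψ_{a' b})`. -/
def reducedA (ψ : Fin 2 → Fin 2 → ℂ) : Matrix (Fin 2) (Fin 2) ℂ :=
  Matrix.of fun a a' => ∑ b : Fin 2, ψ a b * conj (ψ a' b)

/-- The tangle of a normalized two-qubit vector is `4 |det ψ|²`. -/
theorem two_mul_one_sub_trace_reducedA_sq (ψ : Fin 2 → Fin 2 → ℂ)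
    (hψ : (reducedA ψ).trace = 1) :
    2 * (1 - (reducedA ψ * reducedA ψ).trace) =
      4 * ((Matrix.of ψ).det * conj (Matrix.of ψ).det) := by
  have key : (reducedA ψ).trace ^ 2 - (reducedA ψ * reducedA ψ).trace =
      2 * ((Matrix.of ψ).det * conj (Matrix.of ψ).det) := by
    simp only [reducedA, Matrix.trace_fin_two, Matrix.mul_apply, Matrix.of_apply,
      Matrix.det_fin_two, Fin.sum_univ_two, map_sub, map_mul]
    ring
  rw [hψ] at key
  linear_combination 2 * key

theorem exp_I_mul_conj_exp_I (ξ : ℝ) :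
    Complex.exp (Complex.I * ξ) * conj (Complex.exp (Complex.I * ξ)) = 1 := by
  rw [← Complex.exp_conj, ← Complex.exp_add]
  simp

theorem trace_reducedA_bellBasis (δ τ ξ : ℝ) (i : Fin 4) :
    (reducedA (bellBasis δ τ ξ i)).trace = 1 := by
  have hδ := Complex.sin_sq_add_cos_sq (δ : ℂ)
  have hτ := Complex.sin_sq_add_cos_sq (τ : ℂ)
  have hξ := exp_I_mul_conj_exp_I ξ
  fin_cases i <;>
    simp [reducedA, bellBasis, Matrix.trace_fin_two, -Complex.ofReal_sin, -Complex.ofReal_cos,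
      ← Complex.exp_conj] at hξ ⊢ <;>
    push_cast
  · linear_combination Complex.cos δ ^ 2 * hτ + hδ
  · linear_combination Complex.sin δ ^ 2 * hτ + hδ
  · linear_combination Complex.sin δ ^ 2 * hτ + hδ + Complex.cos δ ^ 2 * hξ
  · linear_combination Complex.cos δ ^ 2 * hτ + hδ + Complex.sin δ ^ 2 * hξ

theorem det_bellBasis_mul_conj (δ τ ξ : ℝ) (i : Fin 4) :
    (Matrix.of (bellBasis δ τ ξ i)).det * conj (Matrix.of (bellBasis δ τ ξ i)).det =
      (Complex.sin δ * Complex.cos δ * Complex.sin τ) ^ 2 := by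
  have hξ := exp_I_mul_conj_exp_I ξ
  fin_cases i <;>
    simp [bellBasis, Matrix.det_fin_two, -Complex.ofReal_sin, -Complex.ofReal_cos,
      ← Complex.exp_conj] at hξ ⊢ <;>
    push_cast
  · ring
  · ring
  · linear_combination (Complex.sin δ * Complex.cos δ * Complex.sin τ) ^ 2 * hξ
  · linear_combination (Complex.sin δ * Complex.cos δ * Complex.sin τ) ^ 2 * hξ

/-- **The tangle of every member of the Bell-basis family equals
`sin²(2δ)·sin²(τ)`:** `2(1 − Tr[(Tr_B |ψ_i⟩⟨ψ_i|)²]) = sin²(2δ) sin²(τ)`. -/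
theorem bellBasis_tangle (δ τ ξ : ℝ) (i : Fin 4) :
    (2 : ℂ) * (1 - (reducedA (bellBasis δ τ ξ i) * reducedA (bellBasis δ τ ξ i)).trace)
      = ((Real.sin (2 * δ) ^ 2 * Real.sin τ ^ 2 : ℝ) : ℂ) := by
  rw [two_mul_one_sub_trace_reducedA_sq _ (trace_reducedA_bellBasis δ τ ξ i),
    det_bellBasis_mul_conj]
  push_cast
  rw [Complex.sin_two_mul]
  ring

end
end

section
/- Let τ ∈ ℝ and let ψ_1,…,ψ_4 be the Bell-basis states at δ = π/4, ξ = π/2 (as in the Bell-basis family: ψ_1 = (1/√2)(|01⟩ + sin τ |10⟩ − cos τ |11⟩), ψ_2 = (1/√2)(|01⟩ − sin τ |10⟩ + cos τ |11⟩), ψ_3 = (1/√2)(−i|00⟩ + cos τ |10⟩ + sin τ |11⟩), ψ_4 = (1/√2)(i|00⟩ + cos τ |10⟩ + sin τ |11⟩)). Let A = (σ_x + σ_y)/√2 and A^± = (𝟙 ± A)/2. Then Bob's conditional post-measurement states are pairwise orthogonal within each pair: ⟨ψ_4, (A^+ ⊗ 𝟙)ψ_1⟩ = 0, ⟨ψ_4,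 (A^- ⊗ 𝟙)ψ_1⟩ = 0, ⟨ψ_3, (A^+ ⊗ 𝟙)ψ_2⟩ = 0, and ⟨ψ_3, (A^- ⊗ 𝟙)ψ_2⟩ = 0. -/
open scoped BigOperators ComplexConjugate Matrix
open Matrix

noncomputable section

/-- The Hermitian inner product on `ℂ² ⊗ ℂ²`, conjugate-linear in the first argument. -/
def inner2 (ψ φ : Fin 2 → Fin 2 → ℂ) : ℂ :=
  ∑ a : Fin 2, ∑ b : Fin 2, conj (ψ a b) * φ a b

/-- The Bell-basis states at `δ = π/4`, `ξ = π/2`, as functions on the standard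
product basis; the first index is Alice's qubit. -/
def bellPi4 (τ : ℝ) : Fin 4 → Fin 2 → Fin 2 → ℂ :=
  ![ fun a b => ((Real.sqrt 2 : ℂ))⁻¹ *
        ![![(0 : ℂ), 1], ![(Real.sin τ : ℂ), -(Real.cos τ : ℂ)]] a b,
     fun a b => ((Real.sqrt 2 : ℂ))⁻¹ *
        ![![(0 : ℂ), 1], ![-(Real.sin τ : ℂ), (Real.cos τ : ℂ)]] a b,
     fun a b => ((Real.sqrt 2 : ℂ))⁻¹ *
        ![![-Complex.I, 0], ![(Real.cos τ : ℂ), (Real.sin τ : ℂ)]] a b,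
     fun a b => ((Real.sqrt 2 : ℂ))⁻¹ *
        ![![Complex.I, 0], ![(Real.cos τ : ℂ), (Real.sin τ : ℂ)]] a b ]

/-- The Pauli matrix `σ_x`. -/
def pauliX : Matrix (Fin 2) (Fin 2) ℂ := !![0, 1; 1, 0]

/-- The Pauli matrix `σ_y`. -/
def pauliY : Matrix (Fin 2) (Fin 2) ℂ := !![0, -Complex.I; Complex.I, 0]

/-- Alice's observable `A = (σ_x + σ_y)/√2`. -/
def obsA : Matrix (Fin 2) (Fin 2) ℂ := ((Real.sqrt 2 : ℂ))⁻¹ • (pauliX + pauliY)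

/-- The effect `A^+ = (𝟙 + A)/2`. -/
def Aplus : Matrix (Fin 2) (Fin 2) ℂ := ((2 : ℂ))⁻¹ • (1 + obsA)

/-- The effect `A^- = (𝟙 - A)/2`. -/
def Aminus : Matrix (Fin 2) (Fin 2) ℂ := ((2 : ℂ))⁻¹ • (1 - obsA)

/-- `(M ⊗ 𝟙)ψ`, i.e. a matrix acting on Alice's qubit of a two-qubit vector. -/
def applyA (M : Matrix (Fin 2) (Fin 2) ℂ) (ψ : Fin 2 → Fin 2 → ℂ) :
    Fin 2 → Fin 2 → ℂ :=
  fun a b => ∑ a' : Fin 2, M a a' * ψ a' b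


/-- **Orthogonality of Bob's conditional post-measurement states** for Alice's
measurement `A = (σ_x+σ_y)/√2` on the Bell-basis family at `δ = π/4`, `ξ = π/2`:
within each pair `{ψ_1, ψ_4}` and `{ψ_2, ψ_3}`, Bob's (unnormalized) conditional
states after either outcome of Alice are orthogonal. -/
theorem bob_conditional_states_orthogonal (τ : ℝ) :
    inner2 (bellPi4 τ 3) (applyA Aplus (bellPi4 τ 0)) = 0 ∧
    inner2 (bellPi4 τ 3) (applyA Aminus (bellPi4 τ 0)) = 0 ∧
    inner2 (bellPi4 τ 2) (applyA Aplus (bellPi4 τ 1)) = 0 ∧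
    inner2 (bellPi4 τ 2) (applyA Aminus (bellPi4 τ 1)) = 0 := by
  refine ⟨?_, ?_, ?_, ?_⟩ <;>
    simp only [inner2, bellPi4, applyA, Aplus, Aminus, obsA, pauliX, pauliY,
      Fin.sum_univ_two, Matrix.smul_apply, Matrix.add_apply, Matrix.sub_apply,
      Matrix.one_apply, Matrix.of_apply, Matrix.cons_val, Matrix.cons_val_zero,
      Matrix.cons_val_one, smul_eq_mul, map_mul, map_neg, map_inv₀, map_zero,
      Complex.conj_ofReal, Complex.conj_I, Fin.isValue, if_true, zero_ne_one,
      one_ne_zero, if_false] <;>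
    ring_nf <;> simp only [Complex.I_sq] <;> ring

end
end

section
/- For every τ ∈ ℝ there exists a one-round LOCC measurement with one bit of communication from Alice to Bob, i.e. a 4-outcome measurement (M^λ)_{λ=1}^4 on ℂ²⊗ℂ² of the form M^λ = Σ_{a=1}^2 A^a ⊗ B^{λ|a} with (A^a)_{a=1}^2 a 2-outcome POVM on Alice's qubit and (B^{λ|a})_{λ=1}^4 a 4-outcome POVM on Bob's qubit for each a, whose average success probability on the uniform ensemble of the Bell-basis states at δ = π/4, ξ = π/2 equals (√2 cos τ + 2)/4: Σ_{λ=1}^4 (1/4)·⟨ψ_λ, M^λ ψ_λ⟩ = (√2 cos τ + 2)/4. Moreover the measurement can be chosen non-adaptive, i.e. with B^{λ|1} and B^{λ|2} obtained by classical post-processing of a single fixed POVM on Bob's qubit. -/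
open scoped Kronecker BigOperators ComplexConjugate ComplexOrder
open Matrix

noncomputable section

/-- The expectation value `⟨ψ, M ψ⟩` of a two-qubit operator in a two-qubit vector. -/
def expVal (M : Matrix (Fin 2 × Fin 2) (Fin 2 × Fin 2) ℂ) (ψ : Fin 2 → Fin 2 → ℂ) : ℂ :=
  ∑ p : Fin 2 × Fin 2, ∑ q : Fin 2 × Fin 2,
    conj (ψ p.1 p.2) * M p q * ψ q.1 q.2

/-- Alice's measurement vectors, in the directions `±(X + Y)/√2` of the Bloch sphere. -/
def aliceVec : Fin 2 → Fin 2 → ℂ :=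
  ![![((Real.sqrt 2 : ℂ))⁻¹, (1 + Complex.I) / 2],
    ![((Real.sqrt 2 : ℂ))⁻¹, -(1 + Complex.I) / 2]]

/-- Bob's (unnormalized, orthogonal) measurement vectors. -/
def bobVec (τ : ℝ) : Fin 2 → Fin 2 → ℂ :=
  ![![-((Real.sqrt 2 : ℂ)⁻¹ * (1 - Complex.I)) * (Real.sin τ : ℂ),
      1 + (Real.sqrt 2 : ℂ)⁻¹ * (1 - Complex.I) * (Real.cos τ : ℂ)],
    ![(Real.sqrt 2 : ℂ)⁻¹ * (1 - Complex.I) * (Real.cos τ : ℂ) - Complex.I,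
      (Real.sqrt 2 : ℂ)⁻¹ * (1 - Complex.I) * (Real.sin τ : ℂ)]]

/-- The common squared norm of the two vectors `bobVec τ b`. -/
def bobNormSq (τ : ℝ) : ℝ := Real.sqrt 2 * Real.cos τ + 2

/-- Alice's projective measurement. -/
def alicePOVM (a : Fin 2) : Matrix (Fin 2) (Fin 2) ℂ :=
  vecMulVec (aliceVec a) (star (aliceVec a))

/-- Bob's projective measurement. -/
def bobPOVM (τ : ℝ) (b : Fin 2) : Matrix (Fin 2) (Fin 2) ℂ :=
  (bobNormSq τ : ℂ)⁻¹ • vecMulVec (bobVec τ b) (star (bobVec τ b))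

/-- The label guessed when Alice obtains `a` and Bob obtains `b`. -/
def guess : Fin 2 → Fin 2 → Fin 4 := ![![1, 2], ![0, 3]]

/-- The amplitude of a two-qubit vector along the product vector `x ⊗ y`. -/
def overlap (x y : Fin 2 → ℂ) (ψ : Fin 2 → Fin 2 → ℂ) : ℂ :=
  ∑ p : Fin 2 × Fin 2, conj (x p.1) * conj (y p.2) * ψ p.1 p.2

lemma expVal_rankOne (x y : Fin 2 → ℂ) (k : ℂ) (ψ : Fin 2 → Fin 2 → ℂ) :
    expVal (vecMulVec x (star x) ⊗ₖ (k • vecMulVec y (star y))) ψ =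
      k * (conj (overlap x y ψ) * overlap x y ψ) := by
  simp only [expVal, overlap, map_sum, Finset.sum_mul_sum]
  simp only [Finset.mul_sum]
  refine Finset.sum_congr rfl fun p _ => Finset.sum_congr rfl fun q _ => ?_
  simp only [kroneckerMap_apply, vecMulVec_apply, Matrix.smul_apply, smul_eq_mul, Pi.star_apply,
    map_mul, Complex.conj_conj, RCLike.star_def]
  ring

lemma bobNormSq_pos (τ : ℝ) : 0 < bobNormSq τ := by
  have h2 : Real.sqrt 2 < 2 := by
    rw [Real.sqrt_lt' (by norm_num)]; norm_num
  have := Real.neg_one_le_cos τ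
  unfold bobNormSq
  nlinarith [Real.sqrt_nonneg 2]

lemma inv_sqrt_two_sq : ((Real.sqrt 2 : ℂ))⁻¹ ^ 2 = 1 / 2 := by
  rw [inv_pow, ← Complex.ofReal_pow, Real.sq_sqrt (by norm_num)]
  norm_num

lemma sqrt_two_eq : (Real.sqrt 2 : ℂ) = 2 * (Real.sqrt 2 : ℂ)⁻¹ := by
  have h : (Real.sqrt 2 : ℂ) ≠ 0 := by simp
  field_simp
  rw [← Complex.ofReal_pow, Real.sq_sqrt (by norm_num)]
  norm_num

lemma sin_sq_ofReal (τ : ℝ) : (Real.sin τ : ℂ) ^ 2 = 1 - (Real.cos τ : ℂ) ^ 2 := by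
  rw [← Complex.ofReal_pow, Real.sin_sq]
  push_cast
  ring

lemma isPOVM_alicePOVM : IsPOVM alicePOVM := by
  refine ⟨fun a => posSemidef_vecMulVec_self_star _, ?_⟩
  have hr := inv_sqrt_two_sq
  have hI := Complex.I_sq
  ext i j
  simp only [alicePOVM, Fin.sum_univ_two, Matrix.add_apply, vecMulVec_apply, Pi.star_apply]
  fin_cases i <;> fin_cases j <;> simp [aliceVec] <;> grind

lemma isPOVM_bobPOVM (τ : ℝ) : IsPOVM (bobPOVM τ) := by
  refine ⟨fun b => (posSemidef_vecMulVec_self_star _).smul ?_, ?_⟩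
  · rw [← Complex.ofReal_inv]
    exact_mod_cast (inv_pos.2 (bobNormSq_pos τ)).le
  have hn : (bobNormSq τ : ℂ) ≠ 0 := by exact_mod_cast (bobNormSq_pos τ).ne'
  have hr := inv_sqrt_two_sq
  have h2 := sqrt_two_eq
  have hs := sin_sq_ofReal τ
  have hI := Complex.I_sq
  have hnd : (bobNormSq τ : ℂ) = (Real.sqrt 2 : ℂ) * (Real.cos τ : ℂ) + 2 := by
    simp [bobNormSq]
  simp only [bobPOVM, ← Finset.smul_sum]
  rw [inv_smul_eq_iff₀ hn, hnd]
  ext i j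
  simp only [Fin.sum_univ_two, Matrix.add_apply, vecMulVec_apply, Pi.star_apply, Matrix.smul_apply]
  fin_cases i <;> fin_cases j <;>
    simp [bobVec, -Complex.ofReal_cos, -Complex.ofReal_sin] <;> grind

lemma overlap_guess (τ : ℝ) (a b : Fin 2) :
    conj (overlap (aliceVec a) (bobVec τ b) (bellPi4 τ (guess a b))) *
      overlap (aliceVec a) (bobVec τ b) (bellPi4 τ (guess a b)) =
        ((bobNormSq τ / 2 : ℝ) : ℂ) ^ 2 := by
  have key : overlap (aliceVec a) (bobVec τ b) (bellPi4 τ (guess a b)) =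
        ((bobNormSq τ / 2 : ℝ) : ℂ) ∨
      overlap (aliceVec a) (bobVec τ b) (bellPi4 τ (guess a b)) =
        -((bobNormSq τ / 2 : ℝ) : ℂ) := by
    have hr := inv_sqrt_two_sq
    have h2 := sqrt_two_eq
    have hs := sin_sq_ofReal τ
    have hI := Complex.I_sq
    fin_cases a <;> fin_cases b
    on_goal 4 => right
    on_goal 1 => left
    on_goal 2 => left
    on_goal 3 => left
    all_goals
      simp [overlap, aliceVec, bobVec, bellPi4, guess, bobNormSq, Fintype.sum_prod_type,
        Fin.sum_univ_two, map_ofNat, -Complex.ofReal_cos, -Complex.ofReal_sin]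
      grind
  rcases key with h | h <;> rw [h] <;> simp only [map_neg, Complex.conj_ofReal] <;> ring

lemma expVal_guess (τ : ℝ) (a b : Fin 2) :
    expVal (alicePOVM a ⊗ₖ bobPOVM τ b) (bellPi4 τ (guess a b)) =
      ((bobNormSq τ / 4 : ℝ) : ℂ) := by
  have hn : (bobNormSq τ : ℂ) ≠ 0 := by exact_mod_cast (bobNormSq_pos τ).ne'
  rw [alicePOVM, bobPOVM, expVal_rankOne, overlap_guess]
  push_cast
  field_simp
  norm_num

/-- Post-processing a POVM by a conditional probability distribution gives a POVM. -/
lemma IsPOVM.postprocess {d m N : ℕ} {E : Fin m → Matrix (Fin d) (Fin d) ℂ} (hE : IsPOVM E)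
    {p : Fin N → Fin m → ℝ} (hp : ∀ l b, 0 ≤ p l b) (hp1 : ∀ b, ∑ l, p l b = 1) :
    IsPOVM fun l => ∑ b, (p l b : ℂ) • E b := by
  refine ⟨fun l => posSemidef_sum _ fun b _ => (hE.1 b).smul ?_, ?_⟩
  · exact_mod_cast hp l b
  · rw [Finset.sum_comm]
    simp only [← Finset.sum_smul, ← Complex.ofReal_sum, hp1, Complex.ofReal_one, one_smul]
    exact hE.2

/-- **Alice-first one-round LOCC strategy for the Bell-basis family at
`δ = π/4, ξ = π/2`:** for every `τ` there is a one-round LOCC measurement with one bit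
of communication from Alice to Bob, `M^λ = ∑_{a=1}^2 A^a ⊗ B^{λ|a}`, whose average
success probability on the uniform ensemble equals `(√2 cos τ + 2)/4`; moreover it can
be chosen non-adaptive (Bob's POVMs are classical post-processings of one fixed POVM). -/
theorem alice_to_bob_strategy (τ : ℝ) :
    ∃ (A : Fin 2 → Matrix (Fin 2) (Fin 2) ℂ)
      (B : Fin 2 → Fin 4 → Matrix (Fin 2) (Fin 2) ℂ),
      IsPOVM A ∧ (∀ a, IsPOVM (B a)) ∧
      (∑ lam : Fin 4, (4 : ℂ)⁻¹ *
          expVal (∑ a, A a ⊗ₖ B a lam) (bellPi4 τ lam)) =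
        (((Real.sqrt 2 * Real.cos τ + 2) / 4 : ℝ) : ℂ) ∧
      (∃ (mB : ℕ) (Bfix : Fin mB → Matrix (Fin 2) (Fin 2) ℂ)
          (p : Fin 4 → Fin 2 → Fin mB → ℝ),
          IsPOVM Bfix ∧
          (∀ lam a b, 0 ≤ p lam a b) ∧ (∀ a b, ∑ lam, p lam a b = 1) ∧
          ∀ a lam, B a lam = ∑ b, (p lam a b : ℂ) • Bfix b) := by
  have hp : ∀ (lam : Fin 4) (a b : Fin 2),
      (0 : ℝ) ≤ if lam = guess a b then 1 else 0 := fun _ _ _ => by split <;> norm_num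
  have hp1 : ∀ a b : Fin 2, ∑ lam : Fin 4, (if lam = guess a b then (1 : ℝ) else 0) = 1 :=
    fun a b => by simp
  refine ⟨alicePOVM,
    fun a lam => ∑ b, ((if lam = guess a b then 1 else 0 : ℝ) : ℂ) • bobPOVM τ b,
    isPOVM_alicePOVM,
    fun a => (isPOVM_bobPOVM τ).postprocess (fun lam b => hp lam a b) (hp1 a), ?_,
    2, bobPOVM τ, fun lam a b => if lam = guess a b then 1 else 0,
    isPOVM_bobPOVM τ, hp, hp1, fun _ _ => rfl⟩
  have h00 := expVal_guess τ 0 0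
  have h01 := expVal_guess τ 0 1
  have h10 := expVal_guess τ 1 0
  have h11 := expVal_guess τ 1 1
  simp only [guess, cons_val_zero, cons_val_one] at h00 h01 h10 h11
  simp [Fin.sum_univ_four, Fin.sum_univ_two, guess, h00, h01, h10, h11,
    -Complex.ofReal_cos]
  simp [bobNormSq]
  ring

end
end

section
/- Let τ ∈ ℝ and let ψ_1,…,ψ_4 be the Bell-basis states at δ = π/4, ξ = π/2 (ψ_1 = (1/√2)(|01⟩ + sin τ |10⟩ − cos τ |11⟩), ψ_2 = (1/√2)(|01⟩ − sin τ |10⟩ + cos τ |11⟩), ψ_3 = (1/√2)(−i|00⟩ + cos τ |10⟩ + sin τ |11⟩), ψ_4 = (1/√2)(i|00⟩ + cos τ |10⟩ + sin τ |11⟩)). Let B = sin τ · σ_x + cos τ · σ_z and B^± = (𝟙 ± B)/2. Then Alice's conditional post-measurement states are pairwise orthogonal within each pair: ⟨ψ_2, (𝟙 ⊗ B^+)ψ_1⟩ = 0, ⟨ψ_2, (𝟙 ⊗ B^-)ψ_1⟩ = 0, ⟨ψ_4, (𝟙 ⊗ B^+)ψ_3⟩ = 0, and ⟨ψ_4, (𝟙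 ⊗ B^-)ψ_3⟩ = 0. -/
open scoped BigOperators ComplexConjugate
open Matrix

noncomputable section

/-- The Pauli matrix `σ_z`. -/
def pauliZ : Matrix (Fin 2) (Fin 2) ℂ := !![1, 0; 0, -1]

/-- Bob's observable `B = sin τ · σ_x + cos τ · σ_z`. -/
def obsB (τ : ℝ) : Matrix (Fin 2) (Fin 2) ℂ :=
  (Real.sin τ : ℂ) • pauliX + (Real.cos τ : ℂ) • pauliZ

/-- The effect `B^+ = (𝟙 + B)/2`. -/
def Bplus (τ : ℝ) : Matrix (Fin 2) (Fin 2) ℂ := ((2 : ℂ))⁻¹ • (1 + obsB τ)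

/-- The effect `B^- = (𝟙 - B)/2`. -/
def Bminus (τ : ℝ) : Matrix (Fin 2) (Fin 2) ℂ := ((2 : ℂ))⁻¹ • (1 - obsB τ)

/-- `(𝟙 ⊗ M)ψ`, i.e. a matrix acting on Bob's qubit of a two-qubit vector. -/
def applyB (M : Matrix (Fin 2) (Fin 2) ℂ) (ψ : Fin 2 → Fin 2 → ℂ) :
    Fin 2 → Fin 2 → ℂ :=
  fun a b => ∑ b' : Fin 2, M b b' * ψ a b'


/-- **Orthogonality of Alice's conditional post-measurement states** for Bob's
measurement `B = sin τ σ_x + cos τ σ_z` on the Bell-basis family at `δ = π/4, ξ = π/2`: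
within each pair `{ψ_1, ψ_2}` and `{ψ_3, ψ_4}`, Alice's (unnormalized) conditional
states after either outcome of Bob are orthogonal. -/
theorem alice_conditional_states_orthogonal (τ : ℝ) :
    inner2 (bellPi4 τ 1) (applyB (Bplus τ) (bellPi4 τ 0)) = 0 ∧
    inner2 (bellPi4 τ 1) (applyB (Bminus τ) (bellPi4 τ 0)) = 0 ∧
    inner2 (bellPi4 τ 3) (applyB (Bplus τ) (bellPi4 τ 2)) = 0 ∧
    inner2 (bellPi4 τ 3) (applyB (Bminus τ) (bellPi4 τ 2)) = 0 := by
  have h : (Real.sin τ : ℂ) ^ 2 + (Real.cos τ : ℂ) ^ 2 = 1 := by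
    exact_mod_cast Real.sin_sq_add_cos_sq τ
  refine ⟨?_, ?_, ?_, ?_⟩ <;>
    simp only [inner2, bellPi4, applyB, Bplus, Bminus, obsB, pauliX, pauliZ, Fin.sum_univ_two,
      Matrix.smul_apply, Matrix.add_apply, Matrix.sub_apply, Matrix.one_apply, Matrix.of_apply,
      Matrix.cons_val, map_mul, map_neg, map_zero, map_one, map_inv₀, Complex.conj_ofReal,
      Complex.conj_I, smul_eq_mul, Fin.isValue, if_true, zero_ne_one, one_ne_zero, if_false] <;>
    generalize (Real.sin τ : ℂ) = s at * <;>
    generalize (Real.cos τ : ℂ) = c at * <;>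
    generalize ((Real.sqrt 2 : ℂ))⁻¹ = r <;>
    grind [Complex.I_mul_I]

end
end

section
/- For every τ ∈ ℝ there exists a one-round LOCC measurement with one bit of communication from Bob to Alice, i.e. a 4-outcome measurement (M^λ)_{λ=1}^4 on ℂ²⊗ℂ² of the form M^λ = Σ_{b=1}^2 A^{λ|b} ⊗ B^b with (B^b)_{b=1}^2 a 2-outcome POVM on Bob's qubit (the second factor) and (A^{λ|b})_{λ=1}^4 a 4-outcome POVM on Alice's qubit for each b, whose average success probability on the uniform ensemble of the Bell-basis states at δ = π/4, ξ = π/2 equals (1 + cos τ)/2: Σ_{λ=1}^4 (1/4)·⟨ψ_λ, M^λ ψ_λ⟩ = (1 + cos τ)/2. -/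
open scoped Kronecker BigOperators ComplexConjugate ComplexOrder
open Matrix

noncomputable section

/-- The rank-one matrix `c • v v†` in coordinates is positive semidefinite for `0 ≤ c`. -/
lemma posSemidef_smul_outer {c : ℝ} (hc : 0 ≤ c) (x y : ℂ) :
    (!![(c : ℂ) * (x * conj x), c * (x * conj y);
        c * (y * conj x), c * (y * conj y)] : Matrix (Fin 2) (Fin 2) ℂ).PosSemidef := by
  have h := (posSemidef_vecMulVec_self_star ![x, y]).smul
    (show (0 : ℂ) ≤ (c : ℂ) by exact_mod_cast hc)
  convert h using 1
  ext i j
  fin_cases i <;> fin_cases j <;>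
    simp only [Matrix.smul_apply, vecMulVec_apply] <;> simp

/-- Bob's projective measurement in the basis `(-sin t, cos t)`, `(cos t, sin t)`. -/
def bobMeasurement (t : ℝ) : Fin 2 → Matrix (Fin 2) (Fin 2) ℂ :=
  ![!![(Real.sin t : ℂ) ^ 2, -((Real.sin t : ℂ) * Real.cos t);
      -((Real.sin t : ℂ) * Real.cos t), (Real.cos t : ℂ) ^ 2],
    !![(Real.cos t : ℂ) ^ 2, (Real.sin t : ℂ) * Real.cos t;
      (Real.sin t : ℂ) * Real.cos t, (Real.sin t : ℂ) ^ 2]]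

/-- Alice measures the Pauli `X` observable to tell apart the first two states, or the Pauli `Y`
observable to tell apart the last two, according to Bob's outcome. -/
def aliceMeasurement : Fin 2 → Fin 4 → Matrix (Fin 2) (Fin 2) ℂ :=
  ![![!![1 / 2, -1 / 2; -1 / 2, 1 / 2], !![1 / 2, 1 / 2; 1 / 2, 1 / 2], 0, 0],
    ![0, 0, !![1 / 2, -Complex.I / 2; Complex.I / 2, 1 / 2],
      !![1 / 2, Complex.I / 2; -Complex.I / 2, 1 / 2]]]

lemma isPOVM_bobMeasurement (t : ℝ) : IsPOVM (bobMeasurement t) := by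
  have h : (Real.sin t : ℂ) ^ 2 + (Real.cos t : ℂ) ^ 2 = 1 := by
    exact_mod_cast Real.sin_sq_add_cos_sq t
  constructor
  · intro b
    fin_cases b
    · convert posSemidef_smul_outer zero_le_one (-(Real.sin t : ℂ)) (Real.cos t : ℂ) using 1
      ext i j
      fin_cases i <;> fin_cases j <;>
        simp only [bobMeasurement, map_neg, Complex.conj_ofReal] <;> simp <;> ring
    · convert posSemidef_smul_outer zero_le_one (Real.cos t : ℂ) (Real.sin t : ℂ) using 1
      ext i j
      fin_cases i <;> fin_cases j <;>
        simp only [bobMeasurement, Complex.conj_ofReal] <;> simp <;> ring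
  · rw [Fin.sum_univ_two]
    ext i j
    fin_cases i <;> fin_cases j <;> simp [bobMeasurement, -Complex.ofReal_sin, -Complex.ofReal_cos]
    · exact h
    · rw [add_comm, h]

lemma isPOVM_aliceMeasurement (b : Fin 2) : IsPOVM (aliceMeasurement b) := by
  have half_nonneg : (0 : ℝ) ≤ 1 / 2 := by norm_num
  constructor
  · intro lam
    fin_cases b <;> fin_cases lam
    · convert posSemidef_smul_outer half_nonneg 1 (-1) using 1
      ext i j
      fin_cases i <;> fin_cases j <;> simp [aliceMeasurement] <;> ring
    · convert posSemidef_smul_outer half_nonneg 1 1 using 1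
      ext i j
      fin_cases i <;> fin_cases j <;> simp [aliceMeasurement]
    · exact PosSemidef.zero
    · exact PosSemidef.zero
    · exact PosSemidef.zero
    · exact PosSemidef.zero
    · convert posSemidef_smul_outer half_nonneg (-Complex.I) 1 using 1
      ext i j
      fin_cases i <;> fin_cases j <;> simp [aliceMeasurement] <;> ring
    · convert posSemidef_smul_outer half_nonneg Complex.I 1 using 1
      ext i j
      fin_cases i <;> fin_cases j <;> simp [aliceMeasurement] <;> ring
  · rw [Fin.sum_univ_four]
    ext i j
    fin_cases b <;> fin_cases i <;> fin_cases j <;> simp [aliceMeasurement] <;> ring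

/-- **Bob-first one-round LOCC strategy for the Bell-basis family at
`δ = π/4, ξ = π/2`:** for every `τ` there is a one-round LOCC measurement with one bit
of communication from Bob to Alice, `M^λ = ∑_{b=1}^2 A^{λ|b} ⊗ B^b`, whose average
success probability on the uniform ensemble equals `(1 + cos τ)/2`. -/
theorem bob_to_alice_strategy (τ : ℝ) :
    ∃ (B : Fin 2 → Matrix (Fin 2) (Fin 2) ℂ)
      (A : Fin 2 → Fin 4 → Matrix (Fin 2) (Fin 2) ℂ),
      IsPOVM B ∧ (∀ b, IsPOVM (A b)) ∧
      (∑ lam : Fin 4, (4 : ℂ)⁻¹ *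
          expVal (∑ b, A b lam ⊗ₖ B b) (bellPi4 τ lam)) =
        (((1 + Real.cos τ) / 2 : ℝ) : ℂ) := by
  refine ⟨bobMeasurement (τ / 2), aliceMeasurement, isPOVM_bobMeasurement _,
    isPOVM_aliceMeasurement, ?_⟩
  obtain ⟨t, rfl⟩ : ∃ t, τ = 2 * t := ⟨τ / 2, by ring⟩
  have hsc : (Real.sin t : ℂ) ^ 2 = 1 - (Real.cos t : ℂ) ^ 2 := by
    exact_mod_cast Real.sin_sq t
  have hsqrt : ((Real.sqrt 2 : ℂ))⁻¹ ^ 2 = 1 / 2 := by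
    rw [inv_pow, ← Complex.ofReal_pow, Real.sq_sqrt zero_le_two]
    norm_num
  have hI := Complex.I_sq
  rw [mul_div_cancel_left₀ t two_ne_zero]
  have cons_val_two_four {α : Type} (a b c d : α) : ![a, b, c, d] 2 = c := rfl
  have cons_val_three_four {α : Type} (a b c d : α) : ![a, b, c, d] 3 = d := rfl
  simp only [Fin.sum_univ_four, Fin.sum_univ_two, bellPi4, aliceMeasurement, bobMeasurement,
    Matrix.cons_val_zero, Matrix.cons_val_one, cons_val_two_four, cons_val_three_four]
  simp only [Real.sin_two_mul, Real.cos_two_mul, Complex.ofReal_mul, Complex.ofReal_sub,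
    Complex.ofReal_add, Complex.ofReal_div, Complex.ofReal_pow, Complex.ofReal_one,
    Complex.ofReal_ofNat]
  generalize hS : (Real.sin t : ℂ) = S at *
  generalize hC : (Real.cos t : ℂ) = C at *
  have hS' : conj S = S := by rw [← hS, Complex.conj_ofReal]
  have hC' : conj C = C := by rw [← hC, Complex.conj_ofReal]
  generalize hr : ((Real.sqrt 2 : ℂ))⁻¹ = r at *
  have hr' : conj r = r := by rw [← hr, map_inv₀, Complex.conj_ofReal]
  simp [expVal, Fintype.sum_prod_type,
    hS', hC', hr', map_ofNat, -Complex.ofReal_sin, -Complex.ofReal_cos, -Matrix.cons_val,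
    Matrix.cons_val_zero, Matrix.cons_val_one]
  linear_combination r ^ 2 * (C ^ 2 / 4 - C ^ 2 * S ^ 2 - C ^ 4) * hI +
    2 * r ^ 2 * C ^ 2 * (S ^ 2 + C ^ 2 + 1) * hsc + 2 * C ^ 2 * hsqrt

end
end
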